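/- One-stone corollary, algebraic form: let n ≥ 1, let g₁, …, gₙ each be an arbitrary product of the matrices α, β, γ and their inverses, and let T₁, …, Tₙ each be one of the eleven tile boundary matrices B₁, B₂, B₃, S₁, S₂, N₁, …, N₆, with exactly one index i satisfying Tᵢ ∈ {S₁, S₂} (exactly one stone) and all other Tⱼ bones or snakes. Then the product (g₁·T₁·g₁⁻¹)·(g₂·T₂·g₂⁻¹)·⋯·(gₙ·Tₙ·gₙ⁻¹) equals −I. -/

import Mathlib

open Matrix

/-- `ω = exp(2πi/12)`, a primitive 12th root of unity. -/
noncomputable def ω : ℂ := Complex.exp (2 * Real.pi * Complex.I / 12)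

/-- The SL₂(ℂ) connection matrix on northeast edges. -/
noncomputable def α : Matrix (Fin 2) (Fin 2) ℂ := !![ω^7, 0; 0, ω^5]

/-- The SL₂(ℂ) connection matrix on northwest edges. -/
noncomputable def β : Matrix (Fin 2) (Fin 2) ℂ := !![ω^7, ω^3; 0, ω^5]

/-- The SL₂(ℂ) connection matrix on horizontal edges. -/
noncomputable def γ : Matrix (Fin 2) (Fin 2) ℂ := !![ω^5, 0; ω^3, ω^7]

/-- The length-two move `X = β·α`. -/
noncomputable def X : Matrix (Fin 2) (Fin 2) ℂ := β * α

/-- The length-two move `Y = α⁻¹·γ`. -/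
noncomputable def Y : Matrix (Fin 2) (Fin 2) ℂ := α⁻¹ * γ

/-- The length-two move `Z = γ⁻¹·β⁻¹`. -/
noncomputable def Z : Matrix (Fin 2) (Fin 2) ℂ := γ⁻¹ * β⁻¹

/-- `x = X⁻¹`. -/
noncomputable def x : Matrix (Fin 2) (Fin 2) ℂ := X⁻¹

/-- `y = Y⁻¹`. -/
noncomputable def y : Matrix (Fin 2) (Fin 2) ℂ := Y⁻¹

/-- `z = Z⁻¹`. -/
noncomputable def z : Matrix (Fin 2) (Fin 2) ℂ := Z⁻¹

/-- Bone boundary word `B₁ = Z·Z·Z·Y·z·z·X`. -/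
noncomputable def B₁ : Matrix (Fin 2) (Fin 2) ℂ := Z * Z * Z * Y * z * z * X

/-- Bone boundary word `B₂ = Z·x·x·Y·X·X·X`. -/
noncomputable def B₂ : Matrix (Fin 2) (Fin 2) ℂ := Z * x * x * Y * X * X * X

/-- Bone boundary word `B₃ = Z·Y·Y·Y·X·y·y`. -/
noncomputable def B₃ : Matrix (Fin 2) (Fin 2) ℂ := Z * Y * Y * Y * X * y * y

/-- Stone boundary word `S₁ = Z·Z·Y·Y·X·X`. -/
noncomputable def S₁ : Matrix (Fin 2) (Fin 2) ℂ := Z * Z * Y * Y * X * X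

/-- Stone boundary word `S₂ = y·Z·x·Y·z·X`. -/
noncomputable def S₂ : Matrix (Fin 2) (Fin 2) ℂ := y * Z * x * Y * z * X

/-- Snake boundary word `N₁ = Z·y·Z·Z·Y·z·Y·z·X`. -/
noncomputable def N₁ : Matrix (Fin 2) (Fin 2) ℂ := Z * y * Z * Z * Y * z * Y * z * X

/-- Snake boundary word `N₂ = Z·x·Z·x·Y·X·z·X·X`. -/
noncomputable def N₂ : Matrix (Fin 2) (Fin 2) ℂ := Z * x * Z * x * Y * X * z * X * X

/-- Snake boundary word `N₃ = y·Z·y·Z·Y·Y·z·Y·X`. -/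
noncomputable def N₃ : Matrix (Fin 2) (Fin 2) ℂ := y * Z * y * Z * Y * Y * z * Y * X

/-- Snake boundary word `N₄ = Z·Z·x·Z·Y·z·X·z·X`. -/
noncomputable def N₄ : Matrix (Fin 2) (Fin 2) ℂ := Z * Z * x * Z * Y * z * X * z * X

/-- Snake boundary word `N₅ = Z·x·Y·x·Y·X·X·y·X`. -/
noncomputable def N₅ : Matrix (Fin 2) (Fin 2) ℂ := Z * x * Y * x * Y * X * X * y * X

/-- Snake boundary word `N₆ = y·Z·Y·x·Y·Y·X·y·X`. -/
noncomputable def N₆ : Matrix (Fin 2) (Fin 2) ℂ := y * Z * Y * x * Y * Y * X * y * X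

/-- The eleven tile boundary matrices: three bones, two stones, six snakes. -/
noncomputable def tileBoundaries : Set (Matrix (Fin 2) (Fin 2) ℂ) :=
  {B₁, B₂, B₃, S₁, S₂, N₁, N₂, N₃, N₄, N₅, N₆}

/-- The nine bone and snake boundary matrices. -/
noncomputable def boneSnakeBoundaries : Set (Matrix (Fin 2) (Fin 2) ℂ) :=
  {B₁, B₂, B₃, N₁, N₂, N₃, N₄, N₅, N₆}

theorem omega_pow_four : ω ^ 4 = ω ^ 2 - 1 := by
  have h6 : ω ^ 6 = -1 := by
    rw [ω, ← Complex.exp_nat_mul, ← Complex.exp_pi_mul_I]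
    congr 1
    push_cast
    ring
  have h2 : ω ^ 2 + 1 ≠ 0 := by
    intro h
    have h1 : ω ^ 2 = -1 := by linear_combination h
    have hc : ω ^ 2 = Complex.exp (((Real.pi / 3 : ℝ) : ℂ) * Complex.I) := by
      rw [ω, ← Complex.exp_nat_mul]
      congr 1
      push_cast
      ring
    have hre := congrArg Complex.re (hc.symm.trans h1)
    rw [Complex.exp_ofReal_mul_I_re, Real.cos_pi_div_three] at hre
    norm_num at hre
  refine mul_left_cancel₀ h2 ?_
  linear_combination h6

theorem exists_sq_omega : ∃ ζ : ℂ, ζ ^ 2 = ζ - 1 ∧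
    X = !![ζ, -ζ; 0, 1 - ζ] ∧ Y = !![1 - ζ, 0; 1 - ζ, ζ] ∧ Z = !![1, ζ - 1; ζ, 0] ∧
    x = !![1 - ζ, ζ; 0, ζ] ∧ y = !![ζ, 0; ζ - 1, 1 - ζ] ∧ z = !![0, 1 - ζ; -ζ, 1] := by
  have h := omega_pow_four
  have hα : α⁻¹ = !![ω ^ 5, 0; 0, ω ^ 7] := by
    refine inv_eq_right_inv ?_
    rw [α, mul_fin_two, one_fin_two]
    congr! 4 <;> grind
  have hβ : β⁻¹ = !![ω ^ 5, -ω ^ 3; 0, ω ^ 7] := by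
    refine inv_eq_right_inv ?_
    rw [β, mul_fin_two, one_fin_two]
    congr! 4 <;> grind
  have hγ : γ⁻¹ = !![ω ^ 7, 0; -ω ^ 3, ω ^ 5] := by
    refine inv_eq_right_inv ?_
    rw [γ, mul_fin_two, one_fin_two]
    congr! 4 <;> grind
  have hX : X = !![ω ^ 2, -ω ^ 2; 0, 1 - ω ^ 2] := by
    rw [X, α, β, mul_fin_two]
    congr! 4 <;> grind
  have hY : Y = !![1 - ω ^ 2, 0; 1 - ω ^ 2, ω ^ 2] := by
    rw [Y, hα, γ, mul_fin_two]
    ext i j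
    fin_cases i <;> fin_cases j <;> simp <;> grind
  have hZ : Z = !![1, ω ^ 2 - 1; ω ^ 2, 0] := by
    rw [Z, hβ, hγ, mul_fin_two]
    congr! 4 <;> grind
  refine ⟨ω ^ 2, by linear_combination h, hX, hY, hZ, ?_, ?_, ?_⟩
  · refine inv_eq_right_inv ?_
    rw [hX, mul_fin_two, one_fin_two]
    congr! 4 <;> grind
  · refine inv_eq_right_inv ?_
    rw [hY, mul_fin_two, one_fin_two]
    congr! 4 <;> grind
  · refine inv_eq_right_inv ?_
    rw [hZ, mul_fin_two, one_fin_two]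
    congr! 4 <;> grind

theorem eq_neg_one_of_mem_stones {T : Matrix (Fin 2) (Fin 2) ℂ}
    (hT : T ∈ ({S₁, S₂} : Set (Matrix (Fin 2) (Fin 2) ℂ))) : T = -1 := by
  obtain ⟨ζ, hζ, hX, hY, hZ, hx, hy, hz⟩ := exists_sq_omega
  rcases hT with rfl | rfl
  all_goals
    simp only [S₁, S₂, hX, hY, hZ, hx, hy, hz, mul_fin_two, one_fin_two]
    ext i j
    fin_cases i <;> fin_cases j <;> simp <;> grind

theorem eq_one_of_mem_boneSnakeBoundaries {T : Matrix (Fin 2) (Fin 2) ℂ}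
    (hT : T ∈ boneSnakeBoundaries) : T = 1 := by
  obtain ⟨ζ, hζ, hX, hY, hZ, hx, hy, hz⟩ := exists_sq_omega
  rcases hT with rfl | rfl | rfl | rfl | rfl | rfl | rfl | rfl | rfl
  all_goals
    simp only [B₁, B₂, B₃, N₁, N₂, N₃, N₄, N₅, N₆, hX, hY, hZ, hx, hy, hz, mul_fin_two,
      one_fin_two]
    congr! 4 <;> grind

theorem mem_boneSnakeBoundaries_of_notMem_stones {T : Matrix (Fin 2) (Fin 2) ℂ}
    (hT : T ∈ tileBoundaries) (hS : T ∉ ({S₁, S₂} : Set (Matrix (Fin 2) (Fin 2) ℂ))) :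
    T ∈ boneSnakeBoundaries := by
  simp only [tileBoundaries, boneSnakeBoundaries, Set.mem_insert_iff,
    Set.mem_singleton_iff] at hT hS ⊢
  grind

theorem isUnit_of_mem_closure_connection {g : Matrix (Fin 2) (Fin 2) ℂ}
    (hg : g ∈ Submonoid.closure
      ({α, β, γ, α⁻¹, β⁻¹, γ⁻¹} : Set (Matrix (Fin 2) (Fin 2) ℂ))) : IsUnit g := by
  have hω : ω ≠ 0 := Complex.exp_ne_zero _
  have hα : IsUnit α := by simp [isUnit_iff_isUnit_det, α, hω]
  have hβ : IsUnit β := by simp [isUnit_iff_isUnit_det, β, hω]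
  have hγ : IsUnit γ := by simp [isUnit_iff_isUnit_det, γ, hω]
  refine (Submonoid.closure_le (S := IsUnit.submonoid _)).2 ?_ hg
  rintro _ (rfl | rfl | rfl | rfl | rfl | rfl)
  exacts [hα, hβ, hγ, isUnit_nonsing_inv_iff.2 hα, isUnit_nonsing_inv_iff.2 hβ,
    isUnit_nonsing_inv_iff.2 hγ]

/-- One-stone corollary, algebraic form: a product of conjugated tile boundary matrices
containing exactly one stone equals `-I`. -/
theorem one_stone_boundary_eq_neg_one (n : ℕ) (hn : 1 ≤ n)
    (g T : Fin n → Matrix (Fin 2) (Fin 2) ℂ)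
    (hg : ∀ i, g i ∈ Submonoid.closure
      ({α, β, γ, α⁻¹, β⁻¹, γ⁻¹} : Set (Matrix (Fin 2) (Fin 2) ℂ)))
    (hT : ∀ i, T i ∈ tileBoundaries)
    (hstone : ∃! i, T i ∈ ({S₁, S₂} : Set (Matrix (Fin 2) (Fin 2) ℂ))) :
    (List.ofFn fun i => g i * T i * (g i)⁻¹).prod = -(1 : Matrix (Fin 2) (Fin 2) ℂ) := by
  obtain ⟨k, hk, huniq⟩ := hstone
  have hfactor : ∀ i, g i * T i * (g i)⁻¹ =
      Int.castRingHom (Matrix (Fin 2) (Fin 2) ℂ) (if i = k then -1 else 1) := by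
    intro i
    have hinv : g i * (g i)⁻¹ = 1 :=
      mul_nonsing_inv _ ((isUnit_iff_isUnit_det _).1 (isUnit_of_mem_closure_connection (hg i)))
    split_ifs with hi
    · subst hi
      simp [eq_neg_one_of_mem_stones hk, hinv]
    · have hS := fun h => hi (huniq i h)
      simp [eq_one_of_mem_boneSnakeBoundaries
        (mem_boneSnakeBoundaries_of_notMem_stones (hT i) hS), hinv]
  simp_rw [hfactor]
  rw [← Function.comp_def (Int.castRingHom (Matrix (Fin 2) (Fin 2) ℂ)), ← List.map_ofFn,
    ← map_list_prod, List.prod_ofFn, Finset.prod_ite_eq' Finset.univ k fun _ => (-1 : ℤ)]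
  simp
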